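/- The convex hull of the finite point set {M(t) : t ∈ Y_n} in ℝ^n equals the set of points x = (x_1,…,x_n) ∈ ℝ^n satisfying x_1 + ⋯ + x_n = n(n+1)/2 and p_ω(x) ≥ 0 for every admissible shuffle ω of {1,…,n}. (This convex polytope is a realization of the Stasheff polytope, i.e. associahedron, of dimension n−1.) -/

import Mathlib

/-- Planar binary trees: a tree is either a single leaf, or the grafting
`node l r = l ∨ r` of two planar binary trees. `Y n` is the set of such trees with
`n + 1` leaves. -/
inductive PBT : Type
  | leaf : PBT
  | node : PBT → PBT → PBT
  deriving DecidableEq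

namespace PBT

/-- Number of leaves of a planar binary tree. A tree of `Y n` has `n + 1` leaves. -/
def leaves : PBT → ℕ
  | leaf => 1
  | node l r => l.leaves + r.leaves

/-- The list of coordinates of Loday's point `M(t)`: `M(|)` is the empty tuple and
`M(t^l ∨ t^r) = (M(t^l), p·q, M(t^r))` where `p`, `q` are the numbers of leaves of
`t^l`, `t^r`.  The `i`-th entry is the weight `a_i · b_i` of the `i`-th internal
vertex of `t`.  A tree `t` belongs to `Y n` iff `t.coords.length = n`. -/
noncomputable def coords : PBT → List ℝ
  | leaf => []
  | node l r => l.coords ++ ((l.leaves : ℝ) * (r.leaves : ℝ)) :: r.coords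

/-- The point `M(t) = (a_1 b_1, …, a_n b_n) ∈ ℝ^n`, for `t ∈ Y n`
(coordinates indexed by `Fin n`, the `i`-th coordinate being `x_{i+1}`). -/
noncomputable def M (n : ℕ) (t : PBT) : Fin n → ℝ := fun i => t.coords.getD i 0

end PBT

/-- The affine function `p_ω` associated to the shuffle `ω` whose first block is
`A` and second block is `Aᶜ` (0-indexed: `A ⊆ Fin n` corresponds to
`{ω_1,…,ω_k} ⊆ {1,…,n}`): with `k = |A|`,
`p_ω(x) = (n−k)·(x_{ω_1}+⋯+x_{ω_k}) − k·(x_{ω_{k+1}}+⋯+x_{ω_n}) + n·k·(n−k)/2`. -/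
noncomputable def pShuffle (n : ℕ) (A : Finset (Fin n)) (x : Fin n → ℝ) : ℝ :=
  ((n : ℝ) - A.card) * ∑ i ∈ A, x i - (A.card : ℝ) * ∑ i ∈ Aᶜ, x i
    + (n : ℝ) * A.card * ((n : ℝ) - A.card) / 2

/-- A shuffle (both blocks nonempty) is admissible when its first block is a set of
consecutive integers `{r+1, …, r+k}`, `1 ≤ k ≤ n−1` (0-indexed: `{r, …, r+k−1}`). -/
def IsAdmissible (n : ℕ) (A : Finset (Fin n)) : Prop :=
  ∃ r k : ℕ, 0 < k ∧ k < n ∧ r + k ≤ n ∧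
    A = Finset.univ.filter fun i : Fin n => r ≤ (i : ℕ) ∧ (i : ℕ) < r + k

namespace PBT

theorem leaves_eq_length_add_one (t : PBT) : t.leaves = t.coords.length + 1 := by
  induction t with
  | leaf => simp [leaves, coords]
  | node l r hl hr => simp only [leaves, coords, List.length_append, List.length_cons]; omega

theorem length_coords_node (l r : PBT) :
    (node l r).coords.length = l.coords.length + 1 + r.coords.length := by
  simp only [coords, List.length_append, List.length_cons]; omega

theorem getD_coords_node_left (l r : PBT) {i : ℕ} (h : i < l.coords.length) :
    (node l r).coords.getD i 0 = l.coords.getD i 0 := by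
  simp only [coords]
  exact List.getD_append _ _ _ _ h

theorem getD_coords_node_root (l r : PBT) :
    (node l r).coords.getD l.coords.length 0 =
      ((l.coords.length : ℝ) + 1) * ((r.coords.length : ℝ) + 1) := by
  simp only [coords]
  rw [List.getD_append_right _ _ _ _ le_rfl]
  simp [leaves_eq_length_add_one]

theorem getD_coords_node_right (l r : PBT) (j : ℕ) :
    (node l r).coords.getD (l.coords.length + 1 + j) 0 = r.coords.getD j 0 := by
  simp only [coords]
  rw [List.getD_append_right _ _ _ _ (by omega)]
  rw [show l.coords.length + 1 + j - l.coords.length = j + 1 by omega, List.getD_cons_succ]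

/-- The sum of all coordinates of `M(t)`. -/
theorem sum_coords (t : PBT) :
    ∑ i ∈ Finset.range t.coords.length, t.coords.getD i 0 =
      (t.coords.length : ℝ) * (t.coords.length + 1) / 2 := by
  induction t with
  | leaf => simp [coords]
  | node l r hl hr =>
    rw [length_coords_node, Finset.sum_range_add, Finset.sum_range_succ, getD_coords_node_root,
      Finset.sum_congr rfl fun i hi => getD_coords_node_left l r (Finset.mem_range.1 hi),
      Finset.sum_congr rfl fun j _ => getD_coords_node_right l r j, hl, hr]
    push_cast
    ring

/-- The sum of `k` consecutive coordinates of `M(t)` is at least `k (k + 1) / 2`. -/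
theorem le_sum_consecutive_coords (t : PBT) (a k : ℕ) (h : a + k ≤ t.coords.length) :
    (k : ℝ) * (k + 1) / 2 ≤ ∑ i ∈ Finset.range k, t.coords.getD (a + i) 0 := by
  induction t generalizing a k with
  | leaf =>
    obtain rfl : k = 0 := by simp [coords] at h; omega
    simp
  | node l r hl hr =>
    rw [length_coords_node] at h
    rcases le_or_gt (a + k) l.coords.length with h1 | h1
    · refine (hl a k h1).trans_eq (Finset.sum_congr rfl fun i hi => ?_)
      rw [getD_coords_node_left]
      have := Finset.mem_range.1 hi
      omega
    rcases le_or_gt a l.coords.length with h2 | h2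
    · obtain ⟨p, hp⟩ := Nat.exists_eq_add_of_le h2
      obtain ⟨q, rfl⟩ : ∃ q, k = p + 1 + q := ⟨k - p - 1, by omega⟩
      have el : ∑ i ∈ Finset.range p, (node l r).coords.getD (a + i) 0 =
          ∑ i ∈ Finset.range p, l.coords.getD (a + i) 0 :=
        Finset.sum_congr rfl fun i hi =>
          getD_coords_node_left l r (by have := Finset.mem_range.1 hi; omega)
      have er : ∑ i ∈ Finset.range q, (node l r).coords.getD (a + (p + 1 + i)) 0 =
          ∑ i ∈ Finset.range q, r.coords.getD (0 + i) 0 :=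
        Finset.sum_congr rfl fun i _ => by
          rw [show a + (p + 1 + i) = l.coords.length + 1 + i by omega, getD_coords_node_right,
            zero_add]
      rw [Finset.sum_range_add, Finset.sum_range_succ, el, er, ← hp, getD_coords_node_root]
      have bl := hl a p hp.ge
      have br := hr 0 q (by omega)
      have hpl : (p : ℝ) ≤ l.coords.length := by exact_mod_cast (by omega)
      have hqr : (q : ℝ) ≤ r.coords.length := by exact_mod_cast (by omega)
      have : ((p : ℝ) + 1) * (q + 1) ≤ (l.coords.length + 1) * (r.coords.length + 1) := by gcongr
      push_cast
      linarith
    · obtain ⟨b, rfl⟩ : ∃ b, a = l.coords.length + 1 + b := ⟨a - l.coords.length - 1, by omega⟩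
      refine (hr b k (by omega)).trans_eq (Finset.sum_congr rfl fun i _ => ?_)
      rw [add_assoc, getD_coords_node_right]

theorem finite_setOf_length_coords_le (n : ℕ) : {t : PBT | t.coords.length ≤ n}.Finite := by
  induction n with
  | zero =>
    refine (Set.finite_singleton leaf).subset fun t ht => ?_
    cases t with
    | leaf => rfl
    | node l r =>
      simp only [Set.mem_ofPred_eq, length_coords_node] at ht
      omega
  | succ n ih =>
    refine ((ih.image2 node ih).insert leaf).subset fun t ht => ?_
    cases t with
    | leaf => exact Or.inl rfl
    | node l r =>
      simp only [Set.mem_ofPred_eq, length_coords_node] at ht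
      exact Or.inr ⟨l, by simp only [Set.mem_ofPred_eq]; omega, r,
        by simp only [Set.mem_ofPred_eq]; omega, rfl⟩

/-- For each weight `c` there is a tree, with the smallest weight at its root and recursively so
in both subtrees, which minimizes `c` on the polytope cut out by the interval inequalities. -/
theorem exists_minimizing_tree (k : ℕ) (c : ℕ → ℝ) :
    ∃ t : PBT, t.coords.length = k ∧ ∀ x : ℕ → ℝ,
      (∀ a p : ℕ, a + p ≤ k → (p : ℝ) * (p + 1) / 2 ≤ ∑ i ∈ Finset.range p, x (a + i)) →
      ∀ m : ℝ, (∀ i < k, m ≤ c i) →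
        m * (∑ i ∈ Finset.range k, x i - (k : ℝ) * (k + 1) / 2) ≤
          ∑ i ∈ Finset.range k, c i * (x i - t.coords.getD i 0) := by
  induction k using Nat.strong_induction_on generalizing c with
  | _ k ih =>
    rcases Nat.eq_zero_or_pos k with rfl | hk
    · exact ⟨leaf, by simp [coords], by simp⟩
    obtain ⟨p, hp, hmin⟩ := (Finset.range k).exists_min_image c ⟨0, Finset.mem_range.2 hk⟩
    have hpk := Finset.mem_range.1 hp
    obtain ⟨q, rfl⟩ : ∃ q, k = p + 1 + q := ⟨k - p - 1, by omega⟩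
    obtain ⟨l, rfl, hl⟩ := ih p hpk c
    set p := l.coords.length
    obtain ⟨r, rfl, hr⟩ := ih q (by omega) fun j => c (p + 1 + j)
    set q := r.coords.length
    refine ⟨node l r, length_coords_node l r, fun x hx m hm => ?_⟩
    have bl := hl x (fun a b hab => hx a b (by omega)) (c p)
      fun i hi => hmin i (Finset.mem_range.2 (by omega))
    have br := hr (fun j => x (p + 1 + j))
      (fun a b hab => by simpa only [add_assoc] using hx (p + 1 + a) b (by omega)) (c p)
      fun i hi => hmin _ (Finset.mem_range.2 (by omega))
    have full := hx 0 (p + 1 + q) (by omega)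
    simp only [zero_add] at full
    refine (mul_le_mul_of_nonneg_right (hm p hpk) (sub_nonneg.2 full)).trans ?_
    have el : ∑ i ∈ Finset.range p, c i * (x i - (node l r).coords.getD i 0) =
        ∑ i ∈ Finset.range p, c i * (x i - l.coords.getD i 0) :=
      Finset.sum_congr rfl fun i hi => by rw [getD_coords_node_left l r (Finset.mem_range.1 hi)]
    simp only [Finset.sum_range_add _ (p + 1) q, Finset.sum_range_succ _ p]
    rw [el, getD_coords_node_root]
    simp only [p, getD_coords_node_right] at bl br ⊢
    push_cast
    linear_combination bl + br

end PBT

/-- Sums over an interval of `Fin n` as sums over `Finset.range`. -/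
theorem sum_filter_fin_interval (n r k : ℕ) (h : r + k ≤ n) (g : ℕ → ℝ) :
    ∑ i ∈ Finset.univ.filter (fun i : Fin n => r ≤ (i : ℕ) ∧ (i : ℕ) < r + k), g i =
      ∑ j ∈ Finset.range k, g (r + j) := by
  rw [Finset.sum_filter,
    Fin.sum_univ_eq_sum_range (fun i => if r ≤ i ∧ i < r + k then g i else 0),
    ← Finset.sum_filter]
  have : (Finset.range n).filter (fun i => r ≤ i ∧ i < r + k) = Finset.Ico r (r + k) := by
    ext i
    simp only [Finset.mem_filter, Finset.mem_range, Finset.mem_Ico]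
    omega
  rw [this, Finset.sum_Ico_eq_sum_range, Nat.add_sub_cancel_left]

theorem card_filter_fin_interval (n r k : ℕ) (h : r + k ≤ n) :
    (Finset.univ.filter fun i : Fin n => r ≤ (i : ℕ) ∧ (i : ℕ) < r + k).card = k := by
  have := sum_filter_fin_interval n r k h fun _ => 1
  simp only [Finset.sum_const, nsmul_eq_mul, mul_one, Finset.card_range] at this
  exact_mod_cast this

theorem pShuffle_eq (n : ℕ) (A : Finset (Fin n)) (x : Fin n → ℝ)
    (hx : ∑ i, x i = (n : ℝ) * (n + 1) / 2) :
    pShuffle n A x = n * (∑ i ∈ A, x i - (A.card : ℝ) * (A.card + 1) / 2) := by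
  have h := Finset.sum_add_sum_compl A x
  rw [hx] at h
  rw [pShuffle]
  linear_combination (-(A.card : ℝ)) * h

/-- On the hyperplane `∑ x i = n (n + 1) / 2`, the inequalities `p_ω ≥ 0` for admissible `ω` say
that any `k` consecutive coordinates have sum at least `k (k + 1) / 2`. -/
theorem forall_pShuffle_nonneg_iff (n : ℕ) (g : ℕ → ℝ)
    (hg : ∑ i : Fin n, g i = (n : ℝ) * (n + 1) / 2) :
    (∀ A : Finset (Fin n), IsAdmissible n A → 0 ≤ pShuffle n A fun i => g i) ↔
      ∀ r k : ℕ, r + k ≤ n → (k : ℝ) * (k + 1) / 2 ≤ ∑ j ∈ Finset.range k, g (r + j) := by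
  constructor
  · intro h r k hrk
    rcases Nat.eq_zero_or_pos k with rfl | hk
    · simp
    rcases (show k ≤ n by omega).eq_or_lt with rfl | hkn
    · obtain rfl : r = 0 := by omega
      simp only [zero_add]
      rw [← Fin.sum_univ_eq_sum_range, hg]
    · have := h _ ⟨r, k, hk, hkn, hrk, rfl⟩
      rw [pShuffle_eq n _ _ hg, sum_filter_fin_interval n r k hrk,
        card_filter_fin_interval n r k hrk] at this
      have hn : (0 : ℝ) < n := by exact_mod_cast (by omega)
      exact sub_nonneg.1 (nonneg_of_mul_nonneg_right this hn)
  · rintro h A ⟨r, k, -, -, hrk, rfl⟩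
    rw [pShuffle_eq n _ _ hg, sum_filter_fin_interval n r k hrk,
      card_filter_fin_interval n r k hrk]
    exact mul_nonneg n.cast_nonneg (sub_nonneg.2 (h r k hrk))

theorem convex_setOf_pShuffle_nonneg (n : ℕ) :
    Convex ℝ {x : Fin n → ℝ | (∑ i : Fin n, x i = (n : ℝ) * ((n : ℝ) + 1) / 2) ∧
      ∀ A : Finset (Fin n), IsAdmissible n A → 0 ≤ pShuffle n A x} := by
  rintro x ⟨hx, hx'⟩ y ⟨hy, hy'⟩ a b ha hb hab
  have sum_comb (A : Finset (Fin n)) :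
      ∑ i ∈ A, (a • x + b • y) i = a * ∑ i ∈ A, x i + b * ∑ i ∈ A, y i := by
    simp [Finset.sum_add_distrib, Finset.mul_sum]
  refine ⟨?_, fun A hA => ?_⟩
  · rw [sum_comb, hx, hy, ← add_mul, hab, one_mul]
  · have : pShuffle n A (a • x + b • y) = a * pShuffle n A x + b * pShuffle n A y := by
      simp only [pShuffle, sum_comb]
      linear_combination (-((n : ℝ) * A.card * ((n : ℝ) - A.card) / 2)) * hab
    rw [this]
    exact add_nonneg (mul_nonneg ha (hx' A hA)) (mul_nonneg hb (hy' A hA))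

/-- The convex hull of `{M(t) : t ∈ Y n}` in `ℝ^n` equals the set of points `x` with
`x_1 + ⋯ + x_n = n(n+1)/2` and `p_ω(x) ≥ 0` for every admissible shuffle `ω`: this
convex polytope is a realization of the Stasheff polytope (associahedron) of
dimension `n−1`. -/
theorem stmt3 (n : ℕ) :
    convexHull ℝ {x : Fin n → ℝ | ∃ t : PBT, t.coords.length = n ∧ x = PBT.M n t} =
      {x : Fin n → ℝ | (∑ i : Fin n, x i = (n : ℝ) * ((n : ℝ) + 1) / 2) ∧
        ∀ A : Finset (Fin n), IsAdmissible n A → 0 ≤ pShuffle n A x} := by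
  apply Set.Subset.antisymm
  · refine convexHull_min ?_ (convex_setOf_pShuffle_nonneg n)
    rintro _ ⟨t, rfl, rfl⟩
    have hsum : ∑ i : Fin t.coords.length, t.coords.getD i 0 =
        (t.coords.length : ℝ) * (t.coords.length + 1) / 2 := by
      rw [Fin.sum_univ_eq_sum_range (fun i => t.coords.getD i 0), t.sum_coords]
    exact ⟨hsum, (forall_pShuffle_nonneg_iff _ (fun i => t.coords.getD i 0) hsum).2
      t.le_sum_consecutive_coords⟩
  · rintro x ⟨hsum, hx⟩
    by_contra hnot
    have hfin : {x : Fin n → ℝ | ∃ t : PBT, t.coords.length = n ∧ x = PBT.M n t}.Finite := by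
      refine ((PBT.finite_setOf_length_coords_le n).image (PBT.M n)).subset ?_
      rintro _ ⟨t, ht, rfl⟩
      exact ⟨t, ht.le, rfl⟩
    obtain ⟨f, u, hfu, hux⟩ := geometric_hahn_banach_closed_point (convex_convexHull ℝ _)
      (hfin.isClosed_convexHull ℝ) hnot
    let c : ℕ → ℝ := fun i => if h : i < n then - f (Pi.single ⟨i, h⟩ 1) else 0
    let g : ℕ → ℝ := fun i => if h : i < n then x ⟨i, h⟩ else 0
    have hgx : (fun i : Fin n => g i) = x := by
      ext i
      simp [g]
    have hfc (y : Fin n → ℝ) : f y = - ∑ i : Fin n, c i * y i := by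
      have := LinearMap.pi_apply_eq_sum_univ f.toLinearMap y
      rw [← Finset.sum_neg_distrib]
      refine this.trans (Finset.sum_congr rfl fun i _ => ?_)
      have hi : (fun j => if i = j then (1 : ℝ) else 0) = Pi.single i 1 := by
        ext j
        simp [Pi.single_apply, eq_comm]
      simp [c, hi, mul_comm]
    obtain ⟨t, ht, hmin⟩ := PBT.exists_minimizing_tree n c
    obtain ⟨m, hm⟩ := ((Finset.range n).image c).bddBelow
    have hsum' : ∑ i : Fin n, g i = (n : ℝ) * (n + 1) / 2 := hsum ▸ congrArg (∑ i, · i) hgx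
    have key := hmin g ((forall_pShuffle_nonneg_iff n g hsum').1 (hgx ▸ hx)) m
      fun i hi => hm (Finset.mem_image_of_mem c (Finset.mem_range.2 hi))
    rw [← Fin.sum_univ_eq_sum_range g, hsum', sub_self, mul_zero,
      ← Fin.sum_univ_eq_sum_range (fun i => c i * (g i - t.coords.getD i 0))] at key
    have hMu := hfu _ (subset_convexHull ℝ _ ⟨t, ht, rfl⟩)
    rw [hfc] at hMu hux
    simp only [mul_sub, Finset.sum_sub_distrib] at key
    have hcx : ∑ i : Fin n, c i * g i = ∑ i : Fin n, c i * x i := by rw [← hgx]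
    simp only [PBT.M] at hMu
    linarith
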